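/- arXiv:1704.06636 — 3 statements merged into one kernel-verified Lean document; each statement's English description precedes it below -/
import Mathlib

section
/- For every complex number q with |q| < 1, the sum over odd positive integers n of q^n times the infinite product ∏_{m=1}^∞ (1 - q^{m+n}) equals ∑_{n=1}^∞ (-1)^{n+1} q^{n^2}. (This is the identity F_{S_{1,2}}(q) = ∑_{n≥1} (-1)^{n+1} q^{n^2}.) -/
open Filter Topology Finset

namespace QS

/-- The product `∏_{m ≥ 1} (1 - q^{m+n})`. -/
noncomputable def R (q : ℂ) (n : ℕ) : ℂ := ∏' m : ℕ, (1 - q ^ (m + 1 + n))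

/-- `(q;q)_n`. -/
noncomputable def A (q : ℂ) (n : ℕ) : ℂ := ∏ i ∈ range n, (1 - q ^ (i + 1))

/-- `(-q;q)_n`. -/
noncomputable def B (q : ℂ) (n : ℕ) : ℂ := ∏ i ∈ range n, (1 + q ^ (i + 1))

lemma summable_pow (q : ℂ) (hq : ‖q‖ < 1) (n : ℕ) : Summable fun m : ℕ => ‖q ^ (m + 1 + n)‖ := by
  have h := (summable_nat_add_iff (1 + n)).2 (summable_geometric_of_lt_one (norm_nonneg q) hq)
  refine h.congr fun m => ?_
  rw [norm_pow, add_assoc]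

lemma norm_pow_lt (q : ℂ) (hq : ‖q‖ < 1) (n : ℕ) : ‖q ^ (n + 1)‖ < 1 := by
  rw [norm_pow]
  exact pow_lt_one₀ (norm_nonneg _) hq (by omega)

lemma one_sub_ne (q : ℂ) (hq : ‖q‖ < 1) (n : ℕ) : 1 - q ^ (n + 1) ≠ 0 := by
  intro h
  have h1 := norm_pow_lt q hq n
  rw [← sub_eq_zero.1 h] at h1
  simp at h1

lemma one_add_ne (q : ℂ) (hq : ‖q‖ < 1) (n : ℕ) : 1 + q ^ (n + 1) ≠ 0 := by
  intro h
  have h1 := norm_pow_lt q hq n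
  rw [← neg_eq_iff_add_eq_zero.2 h] at h1
  simp at h1

lemma mult_sub (q : ℂ) (hq : ‖q‖ < 1) (n : ℕ) :
    Multipliable fun m : ℕ => (1 - q ^ (m + 1 + n)) := by
  simpa [sub_eq_add_neg] using multipliable_one_add_of_summable
    (f := fun m : ℕ => -q ^ (m + 1 + n)) (by simpa using summable_pow q hq n)

lemma mult_add (q : ℂ) (hq : ‖q‖ < 1) :
    Multipliable fun m : ℕ => (1 + q ^ (m + 1)) :=
  multipliable_one_add_of_summable (by simpa using summable_pow q hq 0)

lemma R_ne (q : ℂ) (hq : ‖q‖ < 1) : R q 0 ≠ 0 := by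
  have := tprod_one_add_ne_zero_of_summable (f := fun m : ℕ => -q ^ (m + 1))
    (by intro i; simpa [sub_eq_add_neg] using one_sub_ne q hq i)
    (by simpa using summable_pow q hq 0)
  simpa [R, sub_eq_add_neg] using this

lemma A_ne (q : ℂ) (hq : ‖q‖ < 1) (n : ℕ) : A q n ≠ 0 :=
  prod_ne_zero_iff.2 fun i _ => one_sub_ne q hq i

lemma B_ne (q : ℂ) (hq : ‖q‖ < 1) (n : ℕ) : B q n ≠ 0 :=
  prod_ne_zero_iff.2 fun i _ => one_add_ne q hq i

lemma A_tendsto (q : ℂ) (hq : ‖q‖ < 1) : Tendsto (A q) atTop (𝓝 (R q 0)) :=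
  (mult_sub q hq 0).tendsto_prod_tprod_nat

lemma B_tendsto (q : ℂ) (hq : ‖q‖ < 1) : ∃ b : ℂ, b ≠ 0 ∧ Tendsto (B q) atTop (𝓝 b) :=
  ⟨∏' m : ℕ, (1 + q ^ (m + 1)), tprod_one_add_ne_zero_of_summable
    (one_add_ne q hq) (by simpa using summable_pow q hq 0), (mult_add q hq).tendsto_prod_tprod_nat⟩

lemma A_mul_R (q : ℂ) (hq : ‖q‖ < 1) (n : ℕ) : A q n * R q n = R q 0 := by
  have h := Multipliable.prod_mul_tprod_nat_mul' (f := fun m : ℕ => 1 - q ^ (m + 1)) (k := n)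
    (by simpa [add_right_comm] using mult_sub q hq n)
  simpa [A, R, add_right_comm] using h

lemma R_succ (q : ℂ) (hq : ‖q‖ < 1) (n : ℕ) : R q n = (1 - q ^ (n + 1)) * R q (n + 1) := by
  have h1 := A_mul_R q hq n
  have h2 := A_mul_R q hq (n + 1)
  rw [A, prod_range_succ, ← A] at h2
  apply mul_left_cancel₀ (A_ne q hq n)
  rw [h1, ← h2]; ring

lemma R_bdd (q : ℂ) (hq : ‖q‖ < 1) : ∃ C, ∀ n, ‖R q n‖ ≤ C := by
  have h : Tendsto (R q) atTop (𝓝 (R q 0 / R q 0)) := by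
    refine (tendsto_const_nhds.div (A_tendsto q hq) (R_ne q hq)).congr fun n => ?_
    rw [← A_mul_R q hq n]
    simp [A_ne q hq n]
  obtain ⟨C, hC⟩ := (Metric.isBounded_range_of_tendsto _ h).exists_norm_le
  exact ⟨C, fun n => hC _ ⟨n, rfl⟩⟩

/-- The generating function `∑ z^n (q^{n+1};q)_∞`. -/
noncomputable def U (q z : ℂ) : ℂ := ∑' n : ℕ, z ^ n * R q n

lemma U_summable (q z : ℂ) (hq : ‖q‖ < 1) (hz : ‖z‖ < 1) : Summable fun n : ℕ => z ^ n * R q n := by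
  obtain ⟨C, hC⟩ := R_bdd q hq
  refine Summable.of_norm_bounded
    ((summable_geometric_of_lt_one (norm_nonneg z) hz).mul_right C) fun n => ?_
  rw [norm_mul, norm_pow]
  gcongr
  exact hC n

lemma U_step (q z : ℂ) (hq : ‖q‖ < 1) (hz : ‖z‖ < 1) : U q (z * q) = (1 - z) * U q z := by
  have hzq : ‖z * q‖ < 1 := by
    rw [norm_mul]; nlinarith [norm_nonneg z, norm_nonneg q]
  have h1 := U_summable q z hq hz
  have h2 := U_summable q (z * q) hq hzq
  have key : U q z - U q (z * q) = z * U q z := by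
    have h3 := h1.sub h2
    rw [U, U, ← h1.tsum_sub h2, h3.tsum_eq_zero_add, ← tsum_mul_left]
    simp only [pow_zero, sub_self, zero_add]
    refine tsum_congr fun n => ?_
    rw [R_succ q hq n]; ring
  linear_combination -key

lemma U_iter (q z : ℂ) (hq : ‖q‖ < 1) (hz : ‖z‖ < 1) (N : ℕ) :
    U q (z * q ^ N) = (∏ i ∈ range N, (1 - z * q ^ i)) * U q z := by
  induction N with
  | zero => simp
  | succ N ih =>
    have hzq : ‖z * q ^ N‖ < 1 := by
      rw [norm_mul, norm_pow]
      have := pow_le_one₀ (n := N) (norm_nonneg q) hq.le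
      have := pow_nonneg (norm_nonneg q) N
      nlinarith [norm_nonneg z]
    rw [pow_succ, ← mul_assoc, U_step q _ hq hzq, ih, prod_range_succ]; ring

lemma U_tendsto (q z : ℂ) (hq : ‖q‖ < 1) (hz : ‖z‖ < 1) :
    Tendsto (fun N : ℕ => U q (z * q ^ N)) atTop (𝓝 (R q 0)) := by
  obtain ⟨C, hC⟩ := R_bdd q hq
  have h0 : R q 0 = ∑' n : ℕ, (0 : ℂ) ^ n * R q n := by
    rw [tsum_eq_single 0]
    · simp
    · intro n hn; simp [hn]
  rw [h0]
  refine tendsto_tsum_of_dominated_convergence (bound := fun n => ‖z‖ ^ n * C)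
    ((summable_geometric_of_lt_one (norm_nonneg z) hz).mul_right C) ?_ ?_
  · intro n
    refine Tendsto.mul_const _ (Tendsto.pow ?_ n)
    simpa using (tendsto_pow_atTop_nhds_zero_of_norm_lt_one hq).const_mul z
  · refine Eventually.of_forall fun N n => ?_
    rw [norm_mul, norm_pow, norm_mul, norm_pow]
    have := pow_le_one₀ (n := N) (norm_nonneg q) hq.le
    gcongr
    · exact mul_le_of_le_one_right (norm_nonneg z) this
    · exact hC n

lemma U_q (q : ℂ) (hq : ‖q‖ < 1) : U q q = 1 := by
  have h1 := U_tendsto q q hq hq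
  have h2 := (A_tendsto q hq).mul_const (U q q)
  have h3 : (fun N : ℕ => U q (q * q ^ N)) = fun N => A q N * U q q := by
    funext N
    rw [U_iter q q hq hq, A]
    simp only [pow_succ']
  rw [h3] at h1
  have := tendsto_nhds_unique h1 h2
  exact mul_left_cancel₀ (R_ne q hq) (by rw [← this, mul_one])

lemma U_neg (q : ℂ) (hq : ‖q‖ < 1) :
    Tendsto (fun n => A q n / B q n) atTop (𝓝 (U q (-q))) := by
  obtain ⟨b, hb, hB⟩ := B_tendsto q hq
  have hq' : ‖-q‖ < 1 := by simpa using hq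
  have h1 := U_tendsto q (-q) hq hq'
  have h2 := hB.mul_const (U q (-q))
  have h3 : (fun N : ℕ => U q (-q * q ^ N)) = fun N => B q N * U q (-q) := by
    funext N
    rw [U_iter q _ hq hq', B]
    congr 1
    refine prod_congr rfl fun i _ => ?_
    ring
  rw [h3] at h1
  have := tendsto_nhds_unique h1 h2
  have h4 := (A_tendsto q hq).div hB hb
  rw [this, mul_div_cancel_left₀ _ hb] at h4
  exact h4

/-- Auxiliary telescoping sum. -/
lemma tele (q : ℂ) (hq : ‖q‖ < 1) (n k : ℕ) :
    ∑ s ∈ range (k + 1), (-1) ^ s * q ^ (s * (n + 1)) / (1 + q ^ s) * (B q s / A q s) *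
      (q ^ s * (1 - q ^ (n + 1)) - (1 + q ^ (n + 1))) =
    - ((-1) ^ k * q ^ ((k + 1) * (n + 1)) * (B q k / A q k)) := by
  induction k with
  | zero => simp [A, B]; ring
  | succ k ih =>
    rw [sum_range_succ, ih, A, B, A, B, prod_range_succ _ k, prod_range_succ _ k, ← A, ← B]
    have h1 := A_ne q hq k
    have h2 := B_ne q hq k
    have h3 := one_add_ne q hq k
    have h4 := one_sub_ne q hq k
    field_simp
    ring

/-- Finite identity in the style of Shanks. -/
lemma shanks (q : ℂ) (hq : ‖q‖ < 1) (n : ℕ) :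
    1 + 2 * ∑ j ∈ range n, (-1) ^ (j + 1) * q ^ ((j + 1) ^ 2) =
    2 * ∑ s ∈ range (n + 1), (-1) ^ s * q ^ (s * (n + 1)) / (1 + q ^ s) * (B q s / A q s) *
      (A q n / B q n) := by
  induction n with
  | zero => simp [A, B]; norm_num
  | succ n ih =>
    have ht := tele q hq n n
    have hA : A q (n + 1) = A q n * (1 - q ^ (n + 1)) := by rw [A, prod_range_succ, ← A]
    have hB : B q (n + 1) = B q n * (1 + q ^ (n + 1)) := by rw [B, prod_range_succ, ← B]
    have h1 := A_ne q hq n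
    have h2 := B_ne q hq n
    have h3 := one_add_ne q hq n
    have h4 := one_sub_ne q hq n
    have hd : ∑ s ∈ range (n + 1), (-1) ^ s * q ^ (s * (n + 1 + 1)) / (1 + q ^ s) *
        (B q s / A q s) * (A q (n + 1) / B q (n + 1)) =
        ∑ s ∈ range (n + 1), (-1) ^ s * q ^ (s * (n + 1)) / (1 + q ^ s) *
          (B q s / A q s) * (A q n / B q n) +
        (A q n / B q n / (1 + q ^ (n + 1))) *
        ∑ s ∈ range (n + 1), (-1) ^ s * q ^ (s * (n + 1)) / (1 + q ^ s) * (B q s / A q s) *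
      (q ^ s * (1 - q ^ (n + 1)) - (1 + q ^ (n + 1))) := by
      rw [mul_sum, ← sum_add_distrib]
      refine sum_congr rfl fun s _ => ?_
      rw [hA, hB, mul_add s (n + 1) 1, pow_add, mul_one]
      have e : (-1) ^ s * (q ^ (s * (n + 1)) * q ^ s) / (1 + q ^ s) * (B q s / A q s) =
        (-1) ^ s * q ^ (s * (n + 1)) / (1 + q ^ s) * (B q s / A q s) * q ^ s := by ring
      rw [e]
      generalize (-1) ^ s * q ^ (s * (n + 1)) / (1 + q ^ s) * (B q s / A q s) = X
      field_simp
      ring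
    rw [sum_range_succ, mul_add, ← add_assoc, ih, sum_range_succ _ (n + 1), hd, ht, hA, hB]
    generalize ∑ s ∈ range (n + 1), (-1) ^ s * q ^ (s * (n + 1)) / (1 + q ^ s) *
          (B q s / A q s) * (A q n / B q n) = Y
    field_simp
    ring

lemma P_tendsto (q : ℂ) (hq : ‖q‖ < 1) :
    Tendsto (fun n => (1 + 2 * ∑ j ∈ range n, (-1) ^ (j + 1) * q ^ ((j + 1) ^ 2)) - A q n / B q n)
      atTop (𝓝 0) := by
  obtain ⟨b, hb, hB⟩ := B_tendsto q hq
  obtain ⟨C, hC⟩ := (Metric.isBounded_range_of_tendsto _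
    ((A_tendsto q hq).div hB hb)).exists_norm_le
  obtain ⟨D, hD⟩ := (Metric.isBounded_range_of_tendsto _
    (hB.div (A_tendsto q hq) (R_ne q hq))).exists_norm_le
  have hC' : ∀ n, ‖A q n / B q n‖ ≤ C := fun n => hC _ ⟨n, rfl⟩
  have hD' : ∀ n, ‖B q n / A q n‖ ≤ D := fun n => hD _ ⟨n, rfl⟩
  have hD0 : 0 ≤ D := (norm_nonneg _).trans (hD' 0)
  have hlim : Tendsto (fun n : ℕ => (2 * ((1 - ‖q‖)⁻¹ * D * C)) * (n * ‖q‖ ^ n)) atTop (𝓝 0) := by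
    simpa using (tendsto_self_mul_const_pow_of_lt_one (norm_nonneg q) hq).const_mul
      (2 * ((1 - ‖q‖)⁻¹ * D * C))
  refine squeeze_zero_norm (fun n => ?_) hlim
  rw [shanks q hq, sum_range_succ']
  have e0 : (-1 : ℂ) ^ 0 * q ^ (0 * (n + 1)) / (1 + q ^ 0) * (B q 0 / A q 0) *
      (A q n / B q n) = (A q n / B q n) / 2 := by
    simp [A, B]; ring
  rw [e0, mul_add, mul_div_cancel₀ _ (two_ne_zero), add_sub_cancel_right, norm_mul]
  have hle : ‖∑ s ∈ range n, (-1) ^ (s + 1) * q ^ ((s + 1) * (n + 1)) / (1 + q ^ (s + 1)) *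
      (B q (s + 1) / A q (s + 1)) * (A q n / B q n)‖ ≤
      ∑ s ∈ range n, ‖q‖ ^ n * (1 - ‖q‖)⁻¹ * D * C := by
    refine norm_sum_le_of_le _ fun s _ => ?_
    rw [norm_mul, norm_mul, norm_div, norm_mul, norm_pow, norm_pow, norm_neg, norm_one, one_pow,
      one_mul, div_eq_mul_inv]
    have hp : ‖q‖ ^ ((s + 1) * (n + 1)) ≤ ‖q‖ ^ n :=
      pow_le_pow_of_le_one (norm_nonneg q) hq.le (by nlinarith)
    have hpos : 0 < 1 - ‖q‖ := by linarith
    have hden : 1 - ‖q‖ ≤ ‖1 + q ^ (s + 1)‖ := by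
      have h1 : ‖q ^ (s + 1)‖ ≤ ‖q‖ := by
        rw [norm_pow]
        exact pow_le_of_le_one (norm_nonneg q) hq.le (by omega)
      have h2 := norm_sub_norm_le (1 : ℂ) (-q ^ (s + 1))
      rw [norm_neg, sub_neg_eq_add, norm_one] at h2
      linarith
    have hi : ‖1 + q ^ (s + 1)‖⁻¹ ≤ (1 - ‖q‖)⁻¹ := inv_anti₀ hpos hden
    have := hC' n
    have := hD' (s + 1)
    gcongr
  rw [sum_const, card_range, nsmul_eq_mul] at hle
  have : ‖(2 : ℂ)‖ = 2 := by simp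
  rw [this]
  linarith

lemma theta_summable (q : ℂ) (hq : ‖q‖ < 1) :
    Summable fun n : ℕ => (-1 : ℂ) ^ (n + 1) * q ^ ((n + 1) ^ 2) := by
  refine Summable.of_norm_bounded (summable_geometric_of_lt_one (norm_nonneg q) hq) fun n => ?_
  rw [norm_mul, norm_pow, norm_pow, norm_neg, norm_one, one_pow, one_mul]
  exact pow_le_pow_of_le_one (norm_nonneg q) hq.le (by nlinarith)

lemma U_neg_eq (q : ℂ) (hq : ‖q‖ < 1) :
    U q (-q) = 1 + 2 * ∑' n : ℕ, (-1 : ℂ) ^ (n + 1) * q ^ ((n + 1) ^ 2) := by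
  have h1 := (P_tendsto q hq).add (U_neg q hq)
  have h2 := ((theta_summable q hq).hasSum.tendsto_sum_nat.const_mul 2).const_add 1
  simp only [sub_add_cancel, zero_add] at h1
  exact tendsto_nhds_unique h1 h2

end QS


/-- For `|q| < 1`, `F_{S_{1,2}}(q) = ∑_{n ≥ 1} (-1)^{n+1} q^{n²}`, where
`F_{S_{1,2}}(q) = ∑_{n odd} q^n ∏_{m=1}^∞ (1 - q^{m+n})`. -/
theorem stmt0 (q : ℂ) (hq : ‖q‖ < 1) :
    (∑' n : ℕ, if Odd n then q ^ n * ∏' m : ℕ, (1 - q ^ (m + 1 + n)) else 0) =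
      ∑' n : ℕ, (-1 : ℂ) ^ ((n + 1) + 1) * q ^ ((n + 1) ^ 2) := by
  have hq' : ‖-q‖ < 1 := by simpa using hq
  have h1 := QS.U_summable q q hq hq
  have h2 := QS.U_summable q (-q) hq hq'
  have h : (∑' n : ℕ, if Odd n then q ^ n * ∏' m : ℕ, (1 - q ^ (m + 1 + n)) else 0) =
      2⁻¹ * (QS.U q q - QS.U q (-q)) := by
    rw [QS.U, QS.U, ← h1.tsum_sub h2, ← tsum_mul_left]
    refine tsum_congr fun n => ?_
    by_cases hn : Odd n
    · rw [if_pos hn, hn.neg_pow, ← QS.R]; ring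
    · rw [if_neg hn, (Nat.not_odd_iff_even.1 hn).neg_pow]; ring
  rw [h, QS.U_q q hq, QS.U_neg_eq q hq]
  have h3 : ∑' n : ℕ, (-1 : ℂ) ^ ((n + 1) + 1) * q ^ ((n + 1) ^ 2) =
      -∑' n : ℕ, (-1 : ℂ) ^ (n + 1) * q ^ ((n + 1) ^ 2) := by
    rw [← tsum_neg]
    refine tsum_congr fun n => ?_
    rw [pow_succ]; ring
  rw [h3]; ring
end

section
/- For every complex number q with |q| < 1, the sum over even positive integers n of q^n times the infinite product ∏_{m=1}^∞ (1 - q^{m+n}) equals 1 + ∑_{n=1}^∞ (-1)^n q^{n^2} − ∑_{m=−∞}^∞ (-1)^m q^{m(3m−1)/2}. (This is the identity F_{S_{2,2}}(q) = 1 + ∑ (-1)^n q^{n^2} − ∑_m (-1)^m q^{ω(m)}.) -/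
open Filter Topology

namespace Gs

lemma summ (q : ℂ) (hq : ‖q‖ < 1) (k : ℕ) : Summable fun n : ℕ => ‖q ^ (n + 1 + k)‖ := by
  have := (summable_geometric_of_lt_one (norm_nonneg q) hq)
  simp only [norm_pow, add_assoc]
  exact (summable_nat_add_iff (1+k)).2 this

lemma pow_ne_one {q : ℂ} (hq : ‖q‖ < 1) (n : ℕ) : ‖q ^ (n+1)‖ < 1 := by
  rw [norm_pow]; exact pow_lt_one₀ (norm_nonneg q) hq (by omega)

lemma one_sub_ne {q : ℂ} (hq : ‖q‖ < 1) (n : ℕ) : 1 - q ^ (n+1) ≠ 0 := by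
  intro h
  have h1 := pow_ne_one hq n
  rw [← sub_eq_zero.1 h] at h1
  simp at h1

lemma one_add_ne {q : ℂ} (hq : ‖q‖ < 1) (n : ℕ) : 1 + q ^ (n+1) ≠ 0 := by
  intro h
  have h1 := pow_ne_one hq n
  rw [show q ^ (n+1) = -1 by linear_combination h] at h1
  simp at h1

lemma mult (q : ℂ) (hq : ‖q‖ < 1) (k : ℕ) : Multipliable fun n : ℕ => (1 - q ^ (n + 1 + k)) := by
  have := multipliable_one_add_of_summable (f := fun n : ℕ => -q ^ (n + 1 + k))
    (by simpa only [norm_neg] using summ q hq k)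
  simpa only [sub_eq_add_neg] using this

/-- the tail products -/
noncomputable def c (q : ℂ) (n : ℕ) : ℂ := ∏' m : ℕ, (1 - q ^ (m + 1 + n))

/-- finite products -/
noncomputable def A (q : ℂ) (n : ℕ) : ℂ := ∏ i ∈ Finset.range n, (1 - q ^ (i + 1))
noncomputable def B (q : ℂ) (n : ℕ) : ℂ := ∏ i ∈ Finset.range n, (1 + q ^ (i + 1))

lemma A_ne {q : ℂ} (hq : ‖q‖ < 1) (n : ℕ) : A q n ≠ 0 :=
  Finset.prod_ne_zero_iff.2 fun i _ => one_sub_ne hq i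
lemma B_ne {q : ℂ} (hq : ‖q‖ < 1) (n : ℕ) : B q n ≠ 0 :=
  Finset.prod_ne_zero_iff.2 fun i _ => one_add_ne hq i
lemma A_succ (q : ℂ) (n : ℕ) : A q (n+1) = A q n * (1 - q ^ (n+1)) := Finset.prod_range_succ _ _
lemma B_succ (q : ℂ) (n : ℕ) : B q (n+1) = B q n * (1 + q ^ (n+1)) := Finset.prod_range_succ _ _

lemma c_succ (q : ℂ) (hq : ‖q‖ < 1) (n : ℕ) : c q n = (1 - q ^ (n+1)) * c q (n+1) := by
  unfold c
  have := tprod_eq_zero_mul' (f := fun m : ℕ => (1 - q ^ (m + 1 + n)))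
    (by simpa only [add_assoc, add_comm, add_left_comm] using mult q hq (n+1))
  rw [this]
  congr 1
  · ring_nf
  · congr 1; ext m; ring_nf

lemma A_tendsto (q : ℂ) (hq : ‖q‖ < 1) : Tendsto (A q) atTop (𝓝 (c q 0)) :=
  (mult q hq 0).hasProd.tendsto_prod_nat

lemma A_c (q : ℂ) (hq : ‖q‖ < 1) (n : ℕ) : A q n * c q n = c q 0 := by
  induction n with
  | zero => simp [A]
  | succ n ih => rw [A_succ, mul_assoc, ← c_succ q hq, ih]

lemma inv_tendsto (u : ℕ → ℂ) (hu : Summable fun n => ‖u n‖) (h : ∀ n, 1 + u n ≠ 0) :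
    ∃ l, Tendsto (fun n => (∏ i ∈ Finset.range n, (1 + u i))⁻¹) atTop (𝓝 l) := by
  have h0 := tprod_one_add_ne_zero_of_summable h hu
  exact ⟨_, ((multipliable_one_add_of_summable hu).hasProd.tendsto_prod_nat).inv₀ h0⟩

lemma Ainv_tendsto (q : ℂ) (hq : ‖q‖ < 1) : ∃ l, Tendsto (fun n => (A q n)⁻¹) atTop (𝓝 l) := by
  have := inv_tendsto (fun n => - q ^ (n+1)) (by simpa only [norm_neg] using summ q hq 0)
    (by simpa only [sub_eq_add_neg] using one_sub_ne hq)
  simpa only [sub_eq_add_neg, A] using this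

lemma Binv_tendsto (q : ℂ) (hq : ‖q‖ < 1) : ∃ l, Tendsto (fun n => (B q n)⁻¹) atTop (𝓝 l) :=
  inv_tendsto (fun n => q ^ (n+1)) (by simpa only using summ q hq 0) (one_add_ne hq)

lemma B_tendsto (q : ℂ) (hq : ‖q‖ < 1) : ∃ l, Tendsto (fun n => (B q n)) atTop (𝓝 l) :=
  ⟨_, ((multipliable_one_add_of_summable (summ q hq 0)).hasProd.tendsto_prod_nat)⟩

lemma bdd {u : ℕ → ℂ} (h : ∃ l, Tendsto u atTop (𝓝 l)) : ∃ C, 0 ≤ C ∧ ∀ n, ‖u n‖ ≤ C := by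
  obtain ⟨l, hl⟩ := h
  obtain ⟨C, hC⟩ := (Metric.isBounded_range_of_tendsto u hl).exists_norm_le
  exact ⟨C, (norm_nonneg _).trans (hC _ ⟨0, rfl⟩), fun n => hC _ ⟨n, rfl⟩⟩

lemma c_eq (q : ℂ) (hq : ‖q‖ < 1) (n : ℕ) : c q n = c q 0 * (A q n)⁻¹ := by
  rw [← A_c q hq n]; field_simp [A_ne hq n]

lemma c_tendsto (q : ℂ) (hq : ‖q‖ < 1) : Tendsto (c q) atTop (𝓝 1) := by
  obtain ⟨l, hl⟩ := Ainv_tendsto q hq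
  have h1 : Tendsto (fun n => A q n * (A q n)⁻¹) atTop (𝓝 (c q 0 * l)) := (A_tendsto q hq).mul hl
  have h2 : c q 0 * l = 1 := by
    refine tendsto_nhds_unique h1 ?_
    simp only [mul_inv_cancel₀ (A_ne hq _)]
    exact tendsto_const_nhds
  have h3 := hl.const_mul (c q 0)
  rw [h2] at h3
  exact h3.congr fun n => (c_eq q hq n).symm

lemma summ1 (q : ℂ) (hq : ‖q‖ < 1) : Summable fun n => q ^ n * c q n := by
  obtain ⟨C, hC0, hC⟩ := bdd ⟨_, c_tendsto q hq⟩
  refine Summable.of_norm_bounded ((summable_geometric_of_lt_one (norm_nonneg q) hq).mul_right C) ?_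
  intro n
  rw [norm_mul, norm_pow]
  gcongr
  exact hC n

lemma euler1 (q : ℂ) (hq : ‖q‖ < 1) : ∑' n, q ^ n * c q n = 1 := by
  apply HasSum.tsum_eq
  rw [(summ1 q hq).hasSum_iff_tendsto_nat, ← tendsto_add_atTop_iff_nat 1]
  refine (c_tendsto q hq).congr fun n => ?_
  induction n with
  | zero => simp
  | succ n ih => 
    rw [Finset.sum_range_succ, ← ih, c_succ q hq n]; ring

noncomputable def h (q : ℂ) (n : ℕ) : ℂ := ∑' k : ℕ, (-1) ^ k * q ^ ((n+1)*k) * c q k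

lemma hbd (q : ℂ) (hq : ‖q‖ < 1) : ∃ b : ℕ → ℝ, Summable b ∧ ∀ n k : ℕ,
    ‖(-1) ^ k * q ^ ((n+1)*k) * c q k‖ ≤ b k := by
  obtain ⟨C, hC0, hC⟩ := bdd ⟨_, c_tendsto q hq⟩
  refine ⟨_, (summable_geometric_of_lt_one (norm_nonneg q) hq).mul_right C, fun n k => ?_⟩
  rw [norm_mul, norm_mul, norm_pow, norm_pow, norm_neg, norm_one, one_pow, one_mul]
  gcongr ?_ * ?_
  · exact pow_le_pow_of_le_one (norm_nonneg q) hq.le (by nlinarith)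
  · exact hC k

lemma hsumm (q : ℂ) (hq : ‖q‖ < 1) (n : ℕ) :
    Summable fun k : ℕ => (-1) ^ k * q ^ ((n+1)*k) * c q k := by
  obtain ⟨b, hb, h⟩ := hbd q hq
  exact Summable.of_norm_bounded hb (h n)

lemma h_succ (q : ℂ) (hq : ‖q‖ < 1) (n : ℕ) : h q (n+1) = (1 + q ^ (n+1)) * h q n := by
  have h1 : h q n - h q (n+1) = - q ^ (n+1) * h q n := by
    unfold h
    rw [← (hsumm q hq n).tsum_sub (hsumm q hq (n+1)), ← tsum_mul_left,
      ((hsumm q hq n).sub (hsumm q hq (n+1))).tsum_eq_zero_add]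
    simp only [mul_zero, pow_zero, sub_self, zero_add]
    congr 1; ext k
    rw [c_succ q hq k]; ring
  linear_combination -h1

lemma h_eq (q : ℂ) (hq : ‖q‖ < 1) (n : ℕ) : h q n = B q n * h q 0 := by
  induction n with
  | zero => simp [B]
  | succ n ih => rw [h_succ q hq, ih, B_succ]; ring

lemma h_tendsto (q : ℂ) (hq : ‖q‖ < 1) : Tendsto (h q) atTop (𝓝 (c q 0)) := by
  obtain ⟨b, hb, hh⟩ := hbd q hq
  have := tendsto_tsum_of_dominated_convergence (𝓕 := atTop)
    (f := fun (n k : ℕ) => (-1) ^ k * q ^ ((n+1)*k) * c q k)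
    (g := fun k => if k = 0 then c q 0 else 0) hb ?_ (Eventually.of_forall hh)
  · rwa [tsum_ite_eq] at this
  · intro k
    rcases k with _ | k
    · simp
    · simp only [Nat.add_eq_zero_iff, one_ne_zero, and_false, if_false]
      have h1 : Tendsto (fun n : ℕ => q ^ ((n+1)*(k+1))) atTop (𝓝 0) := by
        refine (tendsto_pow_atTop_nhds_zero_of_norm_lt_one hq).comp ?_
        refine tendsto_atTop_mono (fun n => ?_) tendsto_id
        simp only [id]; nlinarith
      simpa using (h1.const_mul ((-1:ℂ)^(k+1))).mul_const (c q (k+1))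

lemma P_tendsto (q : ℂ) (hq : ‖q‖ < 1) :
    Tendsto (fun n => A q n * (B q n)⁻¹) atTop (𝓝 (h q 0)) := by
  obtain ⟨l, hl⟩ := Binv_tendsto q hq
  have h1 := (A_tendsto q hq).mul hl
  have h2 := (h_tendsto q hq).mul hl
  have : c q 0 * l = h q 0 := by
    refine tendsto_nhds_unique h2 ?_
    refine tendsto_const_nhds.congr fun n => ?_
    rw [h_eq q hq n]; field_simp [B_ne hq n]
  rwa [this] at h1

/-- (-1;q)_s -/
noncomputable def M (q : ℂ) (n : ℕ) : ℂ := ∏ i ∈ Finset.range n, (1 + q ^ i)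

lemma M_succ (q : ℂ) (n : ℕ) : M q (n+1) = M q n * (1 + q ^ n) := Finset.prod_range_succ _ _
lemma M_B (q : ℂ) (n : ℕ) : M q (n+1) = 2 * B q n := by
  unfold M B; rw [Finset.prod_range_succ']; norm_num; ring

noncomputable def U (q : ℂ) (n s : ℕ) : ℂ :=
  (-1)^s * q ^ ((n+1)*s) * M q s * A q n * (A q s)⁻¹ * (B q n)⁻¹

lemma wz (q : ℂ) (hq : ‖q‖ < 1) (n s : ℕ) : U q (n+1) s - U q n s =
    U q n (s+1) * (1 - q^(s+1)) / (1 + q^(n+1)) - U q n s * (1 - q^s) / (1 + q^(n+1)) := by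
  have h1 := A_ne hq s
  have h2 := B_ne hq n
  have h3 := one_sub_ne hq s
  have h4 := one_add_ne hq n
  unfold U
  rw [A_succ q s, A_succ q n, B_succ, M_succ]
  have e1 : q ^ ((n+1+1)*s) = q ^ ((n+1)*s) * q^s := by ring
  have e2 : q ^ ((n+1)*(s+1)) = q ^ ((n+1)*s) * q^(n+1) := by ring
  rw [e1, e2]
  generalize q ^ ((n+1)*s) = w at *
  rw [pow_succ (-1 : ℂ)]
  generalize q ^ (n+1) = y at *
  generalize q ^ (s+1) = z at *
  field_simp
  ring

lemma shanks (q : ℂ) (hq : ‖q‖ < 1) (n : ℕ) : ∑ s ∈ Finset.range (n+1), U q n s =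
    1 + 2 * ∑ s ∈ Finset.range n, (-1)^(s+1) * q^((s+1)^2) := by
  induction n with
  | zero => simp [U, M, A, B]
  | succ n ih =>
    rw [Finset.sum_range_succ]
    have h1 : ∑ s ∈ Finset.range (n+1), (U q (n+1) s - U q n s) =
        U q n (n+1) * (1 - q^(n+1)) / (1 + q^(n+1)) := by
      rw [Finset.sum_congr rfl fun s _ => wz q hq n s,
        Finset.sum_range_sub (fun s => U q n s * (1 - q^s) / (1 + q^(n+1)))]
      simp
    rw [Finset.sum_sub_distrib, ih] at h1
    rw [sub_eq_iff_eq_add.1 h1, Finset.sum_range_succ]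
    have h3 : U q n (n+1) * (1 - q^(n+1)) / (1 + q^(n+1)) + U q (n+1) (n+1) =
      2 * ((-1)^(n+1) * q^((n+1)^2)) := by
      have h1 := A_ne hq n
      have h2 := B_ne hq n
      have h3 := one_sub_ne hq n
      have h4 := one_add_ne hq n
      unfold U
      rw [A_succ, B_succ, M_B]
      have e1 : q ^ ((n+1+1)*(n+1)) = q ^ ((n+1)*(n+1)) * q^(n+1) := by ring
      have e2 : q ^ ((n+1)^2) = q ^ ((n+1)*(n+1)) := by ring
      rw [e1, e2]
      generalize q ^ ((n+1)*(n+1)) = w at *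
      generalize q ^ (n+1) = y at *
      field_simp
    linear_combination h3

lemma U_bd (q : ℂ) (hq : ‖q‖ < 1) : ∃ C, 0 ≤ C ∧ ∀ n s, ‖U q n s‖ ≤ C * ‖q‖^((n+1)*s) := by
  obtain ⟨CA, h1, hA⟩ := bdd ⟨_, A_tendsto q hq⟩
  obtain ⟨CB, h2, hB⟩ := bdd (Binv_tendsto q hq)
  obtain ⟨CI, h3, hI⟩ := bdd (Ainv_tendsto q hq)
  obtain ⟨CM, h4, hM⟩ := bdd (u := M q) (by
    obtain ⟨l, hl⟩ := B_tendsto q hq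
    refine ⟨2 * l, (tendsto_add_atTop_iff_nat 1).1 ?_⟩
    simp only [M_B]
    exact hl.const_mul 2)
  refine ⟨CM * CA * CI * CB, by positivity, fun n s => ?_⟩
  unfold U
  simp only [norm_mul, norm_pow, norm_neg, norm_one, one_pow, one_mul]
  calc _ ≤ ‖q‖ ^ ((n + 1) * s) * CM * CA * CI * CB := by
        gcongr
        · exact hM s
        · exact hA n
        · exact hI s
        · exact hB n
    _ = _ := by ring

lemma S_tendsto (q : ℂ) (hq : ‖q‖ < 1) :
    Tendsto (fun n => ∑ s ∈ Finset.range (n+1), U q n s) atTop (𝓝 (h q 0)) := by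
  obtain ⟨C, hC0, hC⟩ := U_bd q hq
  have h0 : ∀ n, ∑ s ∈ Finset.range (n+1), U q n s =
      (∑ s ∈ Finset.range n, U q n (s+1)) + A q n * (B q n)⁻¹ := by
    intro n
    rw [Finset.sum_range_succ']
    congr 1
    simp [U, M, A]
  simp only [h0]
  rw [← zero_add (h q 0)]
  refine Tendsto.add ?_ (P_tendsto q hq)
  have hl : Tendsto (fun n : ℕ => (C * ‖q‖^(n+1)) * (1 - ‖q‖)⁻¹) atTop (𝓝 0) := by
    have := (tendsto_add_atTop_iff_nat 1).2 (tendsto_pow_atTop_nhds_zero_of_lt_one (norm_nonneg q) hq)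
    simpa using (this.const_mul C).mul_const (1 - ‖q‖)⁻¹
  refine squeeze_zero_norm (fun n => ?_) hl
  have hg := summable_geometric_of_lt_one (norm_nonneg q) hq
  calc _ ≤ ∑ s ∈ Finset.range n, (C * ‖q‖^(n+1)) * ‖q‖^s := by
        refine norm_sum_le_of_le _ fun s _ => (hC n (s+1)).trans ?_
        rw [mul_assoc, ← pow_add]
        gcongr ?_ * ?_
        exact pow_le_pow_of_le_one (norm_nonneg q) hq.le (by nlinarith)
    _ ≤ _ := by
      rw [← Finset.mul_sum, ← tsum_geometric_of_lt_one (norm_nonneg q) hq]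
      gcongr
      exact hg.sum_le_tsum _ (fun _ _ => by positivity)

lemma gauss (q : ℂ) (hq : ‖q‖ < 1) :
    h q 0 = 1 + 2 * ∑' n : ℕ, (-1 : ℂ) ^ (n + 1) * q ^ ((n + 1) ^ 2) := by
  have hs : Summable fun n : ℕ => (-1 : ℂ) ^ (n + 1) * q ^ ((n + 1) ^ 2) := by
    refine Summable.of_norm_bounded (summable_geometric_of_lt_one (norm_nonneg q) hq) fun n => ?_
    simp only [norm_mul, norm_pow, norm_neg, norm_one, one_pow, one_mul]
    exact pow_le_pow_of_le_one (norm_nonneg q) hq.le (by nlinarith)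
  refine tendsto_nhds_unique (S_tendsto q hq) ?_
  simp only [shanks q hq]
  exact (hs.hasSum.tendsto_sum_nat.const_mul 2).const_add 1

lemma lhs (q : ℂ) (hq : ‖q‖ < 1) :
    (∑' n : ℕ, if Even n ∧ 0 < n then q ^ n * c q n else 0) = (1 + h q 0) / 2 - c q 0 := by
  have h1 := (summ1 q hq)
  have h2 := (hsumm q hq 0)
  have h3 : Summable fun n : ℕ => if n = 0 then c q 0 else 0 :=
    (hasSum_ite_eq 0 (c q 0)).summable
  have : (1 + h q 0) / 2 - c q 0 = ∑' n : ℕ, ((q ^ n * c q n + 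
      (-1) ^ n * q ^ ((0+1)*n) * c q n) / 2 - if n = 0 then c q 0 else 0) := by
    rw [((h1.add h2).div_const 2).tsum_sub h3, tsum_div_const, h1.tsum_add h2, euler1 q hq,
      tsum_ite_eq]
    rfl
  rw [this]
  congr 1; ext n
  rcases Nat.eq_zero_or_pos n with rfl | hn
  · simp
  · rcases Nat.even_or_odd n with he | ho
    · simp [he, hn, hn.ne', he.neg_one_pow]
    · simp [hn, hn.ne', ho.neg_one_pow, Nat.not_even_iff_odd.2 ho]

lemma pent (q : ℂ) (hq : ‖q‖ < 1) :
    c q 0 = ∑' m : ℤ, (-1 : ℂ) ^ m * q ^ (m * (3 * m - 1) / 2).toNat := by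
  have hg := summable_geometric_of_lt_one (norm_nonneg q) hq
  obtain ⟨C, hC0, hC⟩ : ∃ C, 0 ≤ C ∧ ∀ k n, ‖∏ i ∈ Finset.range (n + 1), (1 - q ^ (k + i + 1))‖ ≤ C := by
    refine ⟨Real.exp (1 - ‖q‖)⁻¹, (Real.exp_pos _).le, fun k n => ?_⟩
    rw [norm_prod]
    calc _ ≤ ∏ i ∈ Finset.range (n+1), Real.exp (‖q‖ ^ i) := by
          refine Finset.prod_le_prod (fun _ _ => norm_nonneg _) fun i _ => ?_
          refine (norm_sub_le _ _).trans ?_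
          rw [norm_one, norm_pow]
          have := Real.add_one_le_exp (‖q‖^i)
          have h2 : ‖q‖ ^ (k+i+1) ≤ ‖q‖^i :=
            pow_le_pow_of_le_one (norm_nonneg q) hq.le (by omega)
          linarith
      _ ≤ _ := by
        rw [← Real.exp_sum, ← tsum_geometric_of_lt_one (norm_nonneg q) hq]
        gcongr
        exact hg.sum_le_tsum _ (fun _ _ => by positivity)
  have hb : ∀ k n : ℕ, ‖q ^ ((k + 1) * n) * ∏ i ∈ Finset.range (n + 1), (1 - q ^ (k + i + 1))‖
      ≤ ‖q‖^n * C := by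
    intro k n
    rw [norm_mul, norm_pow]
    gcongr ?_ * ?_
    · exact pow_le_pow_of_le_one (norm_nonneg q) hq.le (by nlinarith)
    · exact hC k n
  have hp : ∀ k : ℕ, k ≤ pentagonal (-k) := by
    intro k
    have := two_mul_natCast_pentagonal (-k)
    have : (k:ℤ) ≤ pentagonal (-k) := by nlinarith
    exact_mod_cast this
  have hp' : ∀ k : ℕ, k ≤ pentagonal (k+1) := by
    intro k
    have := two_mul_natCast_pentagonal (k+1)
    have : (k:ℤ) ≤ pentagonal (k+1) := by nlinarith
    exact_mod_cast this
  have s1 : Summable fun k : ℕ => (-1:ℂ)^k * q ^ pentagonal (-k) := by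
    refine Summable.of_norm_bounded hg fun n => ?_
    simp only [norm_mul, norm_pow, norm_neg, norm_one, one_pow, one_mul]
    exact pow_le_pow_of_le_one (norm_nonneg q) hq.le (hp n)
  have s2 : Summable fun k : ℕ => (-1:ℂ)^(k+1) * q ^ pentagonal (k+1) := by
    refine Summable.of_norm_bounded hg fun n => ?_
    simp only [norm_mul, norm_pow, norm_neg, norm_one, one_pow, one_mul]
    exact pow_le_pow_of_le_one (norm_nonneg q) hq.le (hp' n)
  have key := Pentagonal.tprod_one_sub_pow (x := q)
    (tendsto_pow_atTop_nhds_zero_of_norm_lt_one hq)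
    (fun k => Summable.of_norm_bounded (hg.mul_right C) (hb k))
    (fun k => by simpa only [add_assoc, add_comm, add_left_comm] using mult q hq k)
    (by
      refine (s1.add s2).congr fun k => ?_
      ring)
    (by
      have hl : Tendsto (fun k : ℕ => ‖q‖^k * ((1 - ‖q‖)⁻¹ * C)) atTop (𝓝 0) := by
        simpa using (tendsto_pow_atTop_nhds_zero_of_lt_one (norm_nonneg q) hq).mul_const ((1 - ‖q‖)⁻¹ * C)
      refine squeeze_zero_norm (fun k => ?_) hl
      simp only [norm_mul, norm_pow, norm_neg, norm_one, one_pow, one_mul]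
      gcongr ?_ * ?_
      · refine pow_le_pow_of_le_one (norm_nonneg q) hq.le ?_
        rw [Nat.le_div_iff_mul_le (by norm_num)]
        nlinarith
      · exact tsum_of_norm_bounded ((hasSum_geometric_of_lt_one (norm_nonneg q) hq).mul_right C) (hb k))
  have e : c q 0 = ∏' n : ℕ, (1 - q ^ (n+1)) := rfl
  rw [e, key]
  symm
  rw [← (Equiv.neg ℤ).tsum_eq]
  have t1 : (fun n : ℕ => (fun m : ℤ => (-1 : ℂ) ^ (Equiv.neg ℤ m) *
      q ^ ((Equiv.neg ℤ m) * (3 * (Equiv.neg ℤ m) - 1) / 2).toNat) n) =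
      fun k : ℕ => (-1:ℂ)^k * q ^ pentagonal (-k) := by
    ext k
    have hi : ((-1:ℂ)^k)⁻¹ = (-1)^k := by rw [← inv_pow]; norm_num
    simp [pentagonal_def, zpow_neg, hi]
  have t2 : (fun n : ℕ => (fun m : ℤ => (-1 : ℂ) ^ (Equiv.neg ℤ m) *
      q ^ ((Equiv.neg ℤ m) * (3 * (Equiv.neg ℤ m) - 1) / 2).toNat) (-(n+1))) =
      fun k : ℕ => (-1:ℂ)^(k+1) * q ^ pentagonal (k+1) := by
    ext k
    simp only [pentagonal_def, Equiv.neg_apply, neg_neg]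
    norm_cast
  rw [tsum_of_nat_of_neg_add_one (by rw [t1]; exact s1) (by rw [t2]; exact s2), t1, t2,
    ← s1.tsum_add s2]
  congr 1; ext k; ring

end Gs

theorem stmt1 (q : ℂ) (hq : ‖q‖ < 1) :
    (∑' n : ℕ, if Even n ∧ 0 < n then q ^ n * ∏' m : ℕ, (1 - q ^ (m + 1 + n)) else 0) =
      1 + (∑' n : ℕ, (-1 : ℂ) ^ (n + 1) * q ^ ((n + 1) ^ 2)) -
        ∑' m : ℤ, (-1 : ℂ) ^ m * q ^ (m * (3 * m - 1) / 2).toNat := by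
  rw [← Gs.pent q hq]
  refine (Gs.lhs q hq).trans ?_
  rw [Gs.gauss q hq]
  ring
end

section
/- For every positive integer n, let D_even^+(n) be the number of partitions of n into an even number of distinct parts with smallest part even, and D_even^-(n) the number of partitions of n into an odd number of distinct parts with smallest part even. Then D_even^+(n) − D_even^-(n) equals: −1 if n is an even perfect square and not a pentagonal number; 1 if n is an odd perfect square and not a pentagonal number; 1 if n = ω(m) for some even integer m and n is not a perfect square; −1 if n = ω(m) for some odd integer m and n is not a perfect square; and 0 otherwise. -/
open scoped Classical

namespace EvenSmallest

section ring
variable {R : Type*} [CommRing R]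

/-- Finite version of `∑ (-q^m)^j (q^{j+1})_∞`. -/
def H (q : R) (m : ℕ) : ℕ → R
  | 0 => 1
  | N + 1 => (1 - q ^ (N + 1)) * H q m N + (-1) ^ (N + 1) * q ^ (m * (N + 1))

theorem H_step (q : R) (m N : ℕ) :
    (1 + q ^ m) * H q m N = H q (m + 1) N + (-1) ^ N * q ^ (m * (N + 1)) := by
  induction N with
  | zero => simp [H]
  | succ N ih =>
    simp only [H]
    have e1 : q ^ ((m + 1) * (N + 1)) = q ^ (m * (N + 1)) * q ^ (N + 1) := by ring
    have e2 : q ^ (m * (N + 1 + 1)) = q ^ (m * (N + 1)) * q ^ m := by ring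
    rw [e1, e2, pow_succ (-1 : R) N]
    linear_combination (1 - q ^ (N + 1)) * ih

theorem H_dvd (q : R) (N m : ℕ) :
    q ^ (N + 1) ∣ H q 1 N * ∏ i ∈ Finset.range m, (1 + q ^ (i + 1)) - H q (m + 1) N := by
  induction m with
  | zero => simp
  | succ m ih =>
    rw [Finset.prod_range_succ]
    have h := H_step q (m + 1) N
    have e : H q 1 N * ((∏ i ∈ Finset.range m, (1 + q ^ (i + 1))) * (1 + q ^ (m + 1)))
        - H q (m + 1 + 1) N =
        (H q 1 N * ∏ i ∈ Finset.range m, (1 + q ^ (i + 1)) - H q (m + 1) N) * (1 + q ^ (m + 1))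
        + q ^ (N + 1) * ((-1) ^ N * q ^ (m * (N + 1))) := by
      have e2 : q ^ ((m + 1) * (N + 1)) = q ^ (N + 1) * q ^ (m * (N + 1)) := by ring
      rw [e2] at h
      linear_combination h
    rw [e]
    exact dvd_add (Dvd.dvd.mul_right ih _) (dvd_mul_right _ _)

theorem H_dvd' (q : R) (N m : ℕ) :
    q ^ m ∣ H q m N - ∏ i ∈ Finset.range N, (1 - q ^ (i + 1)) := by
  induction N with
  | zero => simp [H]
  | succ N ih =>
    rw [Finset.prod_range_succ, H]
    have e : (1 - q ^ (N + 1)) * H q m N + (-1) ^ (N + 1) * q ^ (m * (N + 1))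
        - (∏ i ∈ Finset.range N, (1 - q ^ (i + 1))) * (1 - q ^ (N + 1))
        = (H q m N - ∏ i ∈ Finset.range N, (1 - q ^ (i + 1))) * (1 - q ^ (N + 1))
        + q ^ m * ((-1) ^ (N + 1) * q ^ (m * N)) := by ring
    rw [e]
    exact dvd_add (Dvd.dvd.mul_right ih _) (dvd_mul_right _ _)

theorem H_main (q : R) (N : ℕ) :
    q ^ (N + 1) ∣ H q 1 N * ∏ i ∈ Finset.range N, (1 + q ^ (i + 1))
      - ∏ i ∈ Finset.range N, (1 - q ^ (i + 1)) := by
  have := dvd_add (H_dvd q N N) (H_dvd' q N (N + 1))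
  simpa using this

/-- `(q^{k+1})_n`. -/
def A (q : R) (k n : ℕ) : R := ∏ i ∈ Finset.range n, (1 - q ^ (k + i + 1))
/-- `1/(-q^{k+1})_n`. -/
def G (g : ℕ → R) (k n : ℕ) : R := ∏ i ∈ Finset.range n, g (k + i)
/-- The Rogers-Fine summand. -/
def u (q : R) (g : ℕ → R) (k n : ℕ) : R := A q k n * q ^ ((k + 1) * n) * G g k (n + 1)

theorem A_succ (q : R) (k n : ℕ) : A q k (n + 1) = A q k n * (1 - q ^ (k + n + 1)) := by
  simp [A, Finset.prod_range_succ]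
theorem A_succ' (q : R) (k n : ℕ) : A q k (n + 1) = A q (k + 1) n * (1 - q ^ (k + 1)) := by
  simp only [A, Finset.prod_range_succ']
  simp only [add_zero, add_comm, add_left_comm]
theorem G_succ (g : ℕ → R) (k n : ℕ) : G g k (n + 1) = G g k n * g (k + n) := by
  simp [G, Finset.prod_range_succ]
theorem G_succ' (g : ℕ → R) (k n : ℕ) : G g k (n + 1) = G g (k + 1) n * g k := by
  simp only [G, Finset.prod_range_succ']
  simp only [add_zero, add_comm, add_left_comm]

theorem u_step (q : R) (g : ℕ → R) (hg : ∀ i, g i * (1 + q ^ (i + 1)) = 1) (k n : ℕ) :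
    (1 - q ^ (k + 1)) * (u q g k n + q ^ (2 * k + 3) * u q g (k + 1) n) =
      - u q g k (n + 1) * (1 - q ^ (2 * k + 2 + (n + 1)))
        + u q g k n * (1 - q ^ (2 * k + 2 + n)) := by
  have hA := A_succ' q k n
  rw [A_succ] at hA
  have hG : G g (k + 1) (n + 1) = G g k (n + 2) * (1 + q ^ (k + 1)) := by
    rw [G_succ' g k (n + 1)]; linear_combination (- G g (k + 1) (n + 1)) * hg k
  have h1 := hg (k + n + 1)
  simp only [u]
  rw [hG, A_succ, G_succ g k (n + 1), show k + (n + 1) = k + n + 1 by ring]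
  generalize G g k (n + 1) = Γ at *
  generalize g (k + n + 1) = g1 at *
  have e1 : q ^ (k + n + 1) = q ^ (k + 1) * q ^ n := by ring
  have e2 : q ^ (k + n + 1 + 1) = q ^ (k + 1) * q ^ n * q := by ring
  have e3 : q ^ (2 * k + 3) = q ^ (k + 1) * q ^ (k + 1) * q := by ring
  have e4 : q ^ (2 * k + 2 + (n + 1)) = q ^ (k + 1) * q ^ (k + 1) * q ^ n * q := by ring
  have e5 : q ^ (2 * k + 2 + n) = q ^ (k + 1) * q ^ (k + 1) * q ^ n := by ring
  have e6 : q ^ ((k + 1) * (n + 1)) = q ^ ((k + 1) * n) * q ^ (k + 1) := by ring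
  have e7 : q ^ ((k + 1 + 1) * n) = q ^ ((k + 1) * n) * q ^ n := by ring
  rw [e1] at hA ⊢
  rw [e2] at h1
  rw [e3, e4, e5, e6, e7]
  generalize A q k n = a at *
  generalize A q (k + 1) n = b at *
  generalize q ^ ((k + 1) * n) = T at *
  generalize q ^ (k + 1) = x at *
  generalize q ^ n = y at *
  linear_combination (-(x * x * q * T * y * Γ * g1 * (1 + x))) * hA
    - (a * T * Γ * (x ^ 2 * y - x)) * h1

theorem u_sum (q : R) (g : ℕ → R) (hg : ∀ i, g i * (1 + q ^ (i + 1)) = 1) (k M : ℕ) :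
    (1 - q ^ (k + 1)) * (∑ n ∈ Finset.range M, u q g k n
      + q ^ (2 * k + 3) * ∑ n ∈ Finset.range M, u q g (k + 1) n - 1) =
      - u q g k M * (1 - q ^ (2 * k + 2 + M)) := by
  induction M with
  | zero =>
    have h := hg k
    simp [u, A, G]
    have e : q ^ (2 * k + 2) = q ^ (k + 1) * q ^ (k + 1) := by ring
    rw [e]
    linear_combination (1 - q ^ (k + 1)) * h
  | succ M ih =>
    rw [Finset.sum_range_succ, Finset.sum_range_succ]
    linear_combination ih + u_step q g hg k M

theorem P_mul_G (q : R) (g : ℕ → R) (hg : ∀ i, g i * (1 + q ^ (i + 1)) = 1) (N : ℕ) :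
    A q 0 N * G g 0 N = 1 - 2 * q * ∑ n ∈ Finset.range N, u q g 0 n := by
  induction N with
  | zero => simp [A, G]
  | succ N ih =>
    have h := hg N
    rw [Finset.sum_range_succ, mul_add, ← sub_sub, ← ih, u, A_succ, G_succ]
    simp only [zero_add, one_mul]
    rw [pow_succ] at h ⊢
    linear_combination (A q 0 N * G g 0 N) * h

theorem u_dvd (q : R) (g : ℕ → R) (hg : ∀ i, g i * (1 + q ^ (i + 1)) = 1) (k M : ℕ) :
    q ^ M ∣ ∑ n ∈ Finset.range M, u q g k n
      + q ^ (2 * k + 3) * ∑ n ∈ Finset.range M, u q g (k + 1) n - 1 := by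
  have hc : IsCoprime (q ^ M) (1 - q ^ (k + 1)) := by
    apply IsCoprime.pow_left
    exact ⟨q ^ k, 1, by ring⟩
  apply hc.dvd_of_dvd_mul_left
  rw [u_sum q g hg]
  apply Dvd.dvd.mul_right
  rw [dvd_neg, u]
  apply Dvd.dvd.mul_right
  apply Dvd.dvd.mul_left
  exact pow_dvd_pow _ (by nlinarith)

theorem u_iter (q : R) (g : ℕ → R) (hg : ∀ i, g i * (1 + q ^ (i + 1)) = 1) (M K : ℕ) :
    q ^ M ∣ ∑ n ∈ Finset.range M, u q g 0 n
      - ∑ k ∈ Finset.range K, (-1) ^ k * q ^ (k ^ 2 + 2 * k)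
      - (-1) ^ K * q ^ (K ^ 2 + 2 * K) * ∑ n ∈ Finset.range M, u q g K n := by
  induction K with
  | zero => simp
  | succ K ih =>
    have h := Dvd.dvd.mul_left (u_dvd q g hg K M) ((-1) ^ K * q ^ (K ^ 2 + 2 * K))
    have := dvd_add ih h
    convert this using 1
    rw [Finset.sum_range_succ]
    ring

theorem theta (q : R) (g : ℕ → R) (hg : ∀ i, g i * (1 + q ^ (i + 1)) = 1) (N : ℕ) :
    q ^ (N + 1) ∣ H q 1 N -
      (1 - 2 * ∑ k ∈ Finset.range N, (-1) ^ k * q ^ ((k + 1) ^ 2)) := by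
  have h1 := Dvd.dvd.mul_right (H_main q N) (G g 0 N)
  have hQ : (∏ i ∈ Finset.range N, (1 + q ^ (i + 1))) * G g 0 N = 1 := by
    rw [G, ← Finset.prod_mul_distrib]
    apply Finset.prod_eq_one
    intro i _
    rw [mul_comm, zero_add, hg]
  have hP := P_mul_G q g hg N
  have hA : A q 0 N = ∏ i ∈ Finset.range N, (1 - q ^ (i + 1)) := by simp [A]
  rw [hA] at hP
  have h2 := u_iter q g hg N N
  have h3 : q ^ N ∣ ∑ n ∈ Finset.range N, u q g 0 n
      - ∑ k ∈ Finset.range N, (-1) ^ k * q ^ (k ^ 2 + 2 * k) := by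
    have h4 : q ^ N ∣ (-1) ^ N * q ^ (N ^ 2 + 2 * N) * ∑ n ∈ Finset.range N, u q g N n :=
      Dvd.dvd.mul_right (Dvd.dvd.mul_left (pow_dvd_pow _ (by nlinarith)) _) _
    simpa using dvd_add h2 h4
  have h5 := Dvd.dvd.mul_left (mul_dvd_mul_right h3 q) 2
  rw [← pow_succ] at h5
  have e : ∑ k ∈ Finset.range N, (-1) ^ k * q ^ ((k + 1) ^ 2) =
      q * ∑ k ∈ Finset.range N, (-1) ^ k * q ^ (k ^ 2 + 2 * k) := by
    rw [Finset.mul_sum]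
    exact Finset.sum_congr rfl fun k _ => by ring
  have h6 := dvd_sub h1 h5
  convert h6 using 1
  rw [e]
  linear_combination (- H q 1 N) * hQ + hP
end ring

open PowerSeries

theorem exists_g : ∃ g : ℕ → ℤ⟦X⟧, ∀ i, g i * (1 + X ^ (i + 1)) = 1 := by
  have : ∀ i : ℕ, ∃ y : ℤ⟦X⟧, y * (1 + X ^ (i + 1)) = 1 := by
    intro i
    have hu : IsUnit (1 + X ^ (i + 1) : ℤ⟦X⟧) := by
      rw [PowerSeries.isUnit_iff_constantCoeff]; simp
    obtain ⟨y, hy⟩ := hu.exists_left_inv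
    exact ⟨y, hy⟩
  choose g hg using this
  exact ⟨g, hg⟩

theorem coeff_H {n N : ℕ} (hn : 0 < n) (hN : n ≤ N) :
    coeff n (H (X : ℤ⟦X⟧) 1 N) =
      - 2 * ∑ k ∈ Finset.range N, if n = (k + 1) ^ 2 then (-1 : ℤ) ^ k else 0 := by
  obtain ⟨g, hg⟩ := exists_g
  have h := PowerSeries.X_pow_dvd_iff.mp (theta (X : ℤ⟦X⟧) g hg N) n (by omega)
  rw [map_sub, sub_eq_zero] at h
  rw [h, map_sub, show (2 : ℤ⟦X⟧) = C (2 : ℤ) by simp, coeff_C_mul, map_sum, coeff_one,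
    if_neg hn.ne']
  have : ∀ k, coeff n ((-1) ^ k * (X : ℤ⟦X⟧) ^ ((k + 1) ^ 2)) =
      if n = (k + 1) ^ 2 then (-1 : ℤ) ^ k else 0 := by
    intro k
    rw [show ((-1) ^ k : ℤ⟦X⟧) = C ((-1 : ℤ) ^ k) by simp, coeff_C_mul, coeff_X_pow]
    simp
  simp only [this]
  ring

/-- The smallest element is even. -/
def SE (S : Finset ℕ) : Prop := ∃ s ∈ S, Even s ∧ ∀ x ∈ S, s ≤ x

/-- Signed generating function of sets of parts at most `N` with even least element. -/
noncomputable def E (N : ℕ) : ℤ⟦X⟧ :=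
  ∑ S ∈ (Finset.Icc 1 N).powerset, if SE S then (-1) ^ S.card * X ^ (∑ i ∈ S, i) else 0

theorem SE_insert {N : ℕ} {S : Finset ℕ} (hS : S ⊆ Finset.Icc 1 N) (hne : S.Nonempty) :
    SE (insert (N + 1) S) ↔ SE S := by
  constructor
  · rintro ⟨s, hs, he, hle⟩
    obtain ⟨a, ha⟩ := hne
    have h1 := Finset.mem_Icc.mp (hS ha)
    have h2 := hle a (Finset.mem_insert_of_mem ha)
    rcases Finset.mem_insert.mp hs with rfl | hs
    · omega
    · exact ⟨s, hs, he, fun x hx => hle x (Finset.mem_insert_of_mem hx)⟩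
  · rintro ⟨s, hs, he, hle⟩
    refine ⟨s, Finset.mem_insert_of_mem hs, he, fun x hx => ?_⟩
    rcases Finset.mem_insert.mp hx with rfl | hx
    · have h1 := Finset.mem_Icc.mp (hS hs)
      omega
    · exact hle x hx

theorem E_succ (N : ℕ) :
    E (N + 1) = (1 - X ^ (N + 1)) * E N - if Even (N + 1) then X ^ (N + 1) else 0 := by
  have hI : Finset.Icc 1 (N + 1) = insert (N + 1) (Finset.Icc 1 N) := by
    ext x; simp; omega
  have hnot : N + 1 ∉ Finset.Icc 1 N := by simp
  rw [E, hI, Finset.sum_powerset_insert hnot]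
  have key : ∑ t ∈ (Finset.Icc 1 N).powerset,
      (if SE (insert (N + 1) t) then (-1 : ℤ⟦X⟧) ^ (insert (N + 1) t).card *
        X ^ (∑ i ∈ insert (N + 1) t, i) else 0) =
      ∑ t ∈ (Finset.Icc 1 N).powerset,
        ((- X ^ (N + 1)) * (if SE t then (-1 : ℤ⟦X⟧) ^ t.card * X ^ (∑ i ∈ t, i) else 0)
        - if t = ∅ then (if Even (N + 1) then X ^ (N + 1) else 0) else 0) := by
    apply Finset.sum_congr rfl
    intro t ht
    rw [Finset.mem_powerset] at ht
    have hnt : N + 1 ∉ t := fun h => hnot (ht h)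
    rcases t.eq_empty_or_nonempty with rfl | hne
    · simp only [SE]
      by_cases h : Even (N + 1) <;> simp [h]
    · rw [if_neg hne.ne_empty, Finset.card_insert_of_notMem hnt, Finset.sum_insert hnt]
      simp only [SE_insert ht hne]
      split_ifs
      · ring
      · ring
  rw [key, Finset.sum_sub_distrib, ← Finset.mul_sum, Finset.sum_ite_eq']
  simp only [Finset.empty_mem_powerset, if_true]
  rw [← E]
  ring

theorem two_E (N : ℕ) :
    2 * E N = 2 * ∏ i ∈ Finset.range N, (1 - X ^ (i + 1)) - 1 - H (X : ℤ⟦X⟧) 1 N := by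
  induction N with
  | zero => simp [E, SE, H]; norm_num
  | succ N ih =>
    rw [E_succ, Finset.prod_range_succ, H]
    rcases Nat.even_or_odd (N + 1) with h | h
    · rw [if_pos h, h.neg_one_pow, one_mul (N + 1)]
      linear_combination (1 - X ^ (N + 1)) * ih
    · rw [if_neg (Nat.not_even_iff_odd.mpr h), h.neg_one_pow, one_mul (N + 1)]
      linear_combination (1 - X ^ (N + 1)) * ih

theorem coeff_E (n N : ℕ) : coeff n (E N) =
    ∑ S ∈ (Finset.Icc 1 N).powerset with SE S ∧ ∑ i ∈ S, i = n, (-1 : ℤ) ^ S.card := by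
  rw [E, map_sum, Finset.sum_filter]
  apply Finset.sum_congr rfl
  intro S _
  by_cases h : SE S
  · rw [if_pos h, show ((-1) ^ S.card : ℤ⟦X⟧) = C ((-1 : ℤ) ^ S.card) by simp, coeff_C_mul,
      coeff_X_pow]
    simp only [h, true_and, @eq_comm _ n]
    split_ifs <;> simp
  · simp [h]

theorem D_eq {n N : ℕ} (hN : n ≤ N) :
    ((Finset.univ.filter fun l : n.Partition =>
        l.parts.Nodup ∧ Even (Multiset.card l.parts) ∧
          ∃ s ∈ l.parts, Even s ∧ ∀ x ∈ l.parts, s ≤ x).card : ℤ) -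
      ((Finset.univ.filter fun l : n.Partition =>
        l.parts.Nodup ∧ Odd (Multiset.card l.parts) ∧
          ∃ s ∈ l.parts, Even s ∧ ∀ x ∈ l.parts, s ≤ x).card : ℤ) = coeff n (E N) := by
  have h1 : ∑ l ∈ (Finset.univ : Finset n.Partition) with
      (l.parts.Nodup ∧ ∃ s ∈ l.parts, Even s ∧ ∀ x ∈ l.parts, s ≤ x),
      (-1 : ℤ) ^ (Multiset.card l.parts) = coeff n (E N) := by
    rw [coeff_E]
    refine Finset.sum_bij' (fun l _ => l.parts.toFinset)
      (fun S hS => ⟨S.val, fun {i} hi => ?_, ?_⟩) ?_ ?_ ?_ ?_ ?_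
    · have := (Finset.mem_powerset.mp (Finset.mem_filter.mp hS).1) hi
      have := Finset.mem_Icc.mp this
      omega
    · have := (Finset.mem_filter.mp hS).2.2
      rw [Finset.sum, Multiset.map_id'] at this
      exact this
    · intro l hl
      obtain ⟨-, hnd, hs⟩ := Finset.mem_filter.mp hl
      rw [Finset.mem_filter, Finset.mem_powerset]
      refine ⟨fun x hx => ?_, ?_, ?_⟩
      · rw [Multiset.mem_toFinset] at hx
        have := Nat.Partition.le_of_mem_parts hx
        have := l.parts_pos hx
        rw [Finset.mem_Icc]; omega
      · simpa [SE] using hs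
      · rw [Finset.sum, Multiset.toFinset_val, hnd.dedup]
        simpa using l.parts_sum
    · intro S hS
      obtain ⟨-, hs, -⟩ := Finset.mem_filter.mp hS
      rw [Finset.mem_filter]
      exact ⟨Finset.mem_univ _, S.nodup, hs⟩
    · intro l hl
      obtain ⟨-, hnd, hs⟩ := Finset.mem_filter.mp hl
      ext1
      simp [hnd.dedup]
    · intro S hS
      simp
    · intro l hl
      obtain ⟨-, hnd, hs⟩ := Finset.mem_filter.mp hl
      rw [Multiset.toFinset_card_of_nodup hnd]
  rw [← h1, Finset.card_filter, Finset.card_filter, Finset.sum_filter]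
  push_cast
  rw [← Finset.sum_sub_distrib]
  apply Finset.sum_congr rfl
  intro l _
  rcases Nat.even_or_odd (Multiset.card l.parts) with h | h
  · have h' := Nat.not_odd_iff_even.mpr h
    simp only [h, h', h.neg_one_pow]
    simp
  · have h' := Nat.not_even_iff_odd.mpr h
    simp only [h, h', h.neg_one_pow]
    simp
    split_ifs <;> simp

theorem coeff_E_main {n : ℕ} (hn : 0 < n) : ∃ N, n ≤ N ∧ coeff n (E N) =
    (pentagonalSeries ℤ).coeff n +
      ∑ k ∈ Finset.range N, if n = (k + 1) ^ 2 then (-1 : ℤ) ^ k else 0 := by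
  obtain ⟨s, hs⟩ := Filter.eventually_atTop.mp (coeff_prod_one_sub_X_pow_eventually_eq ℤ n)
  obtain ⟨M, hM⟩ := s.exists_nat_subset_range
  refine ⟨max n M, le_max_left _ _, ?_⟩
  have h1 := hs (Finset.range (max n M))
    (hM.trans (Finset.range_subset_range.mpr (le_max_right _ _)))
  have h2 := congrArg (coeff n) (two_E (max n M))
  rw [show (2 : ℤ⟦X⟧) = C (2 : ℤ) by simp, map_sub, map_sub, coeff_C_mul, coeff_C_mul, h1,
    coeff_H hn (le_max_left _ _), coeff_one, if_neg hn.ne'] at h2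
  linarith

theorem sq_sum {n N : ℕ} (hN : n ≤ N) (j : ℕ) (hj : 0 < j) (h : n = j ^ 2) :
    (∑ k ∈ Finset.range N, if n = (k + 1) ^ 2 then (-1 : ℤ) ^ k else 0) = - (-1) ^ j := by
  obtain ⟨k, rfl⟩ : ∃ k, j = k + 1 := ⟨j - 1, by omega⟩
  rw [Finset.sum_eq_single k]
  · rw [if_pos h]; ring
  · intro b _ hb
    rw [if_neg]
    intro h'
    apply hb
    have := Nat.pow_left_injective (n := 2) (by norm_num) (h'.symm.trans h)
    simpa using this
  · intro hk
    exfalso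
    apply hk
    rw [Finset.mem_range]
    nlinarith

theorem sq_sum' {n N : ℕ} (h : ¬ IsSquare n) :
    (∑ k ∈ Finset.range N, if n = (k + 1) ^ 2 then (-1 : ℤ) ^ k else 0) = 0 := by
  apply Finset.sum_eq_zero
  intro k _
  rw [if_neg]
  rintro rfl
  exact h ⟨k + 1, by ring⟩

theorem pent_coeff {n : ℕ} {m : ℤ} (h : 2 * (n : ℤ) = m * (3 * m - 1)) :
    (pentagonalSeries ℤ).coeff n = Int.negOnePow m := by
  have h2 := two_mul_natCast_pentagonal m
  have : n = pentagonal m := by omega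
  rw [this, coeff_pentagonalSeries_pentagonal]
  rfl

theorem pent_coeff' {n : ℕ} (h : ¬ ∃ m : ℤ, 2 * (n : ℤ) = m * (3 * m - 1)) :
    (pentagonalSeries ℤ).coeff n = 0 := by
  apply coeff_pentagonalSeries_eq_zero
  rintro ⟨m, rfl⟩
  exact h ⟨m, two_mul_natCast_pentagonal m⟩

theorem parity {m k : ℤ} (h : 2 * k ^ 2 = m * (3 * m - 1)) : Even m ↔ Even k := by
  rcases Int.even_or_odd m with hm | hm
  · simp only [hm, true_iff]
    obtain ⟨t, rfl⟩ := hm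
    have h1 : t * (6 * t - 1) = k ^ 2 := by linarith
    have hc : IsCoprime t (6 * t - 1) := ⟨6, -1, by ring⟩
    obtain ⟨a, ha⟩ := Int.sq_of_isCoprime hc h1
    obtain ⟨b, hb⟩ := Int.sq_of_isCoprime hc.symm (by rw [mul_comm]; exact h1)
    by_contra hk
    rw [Int.not_even_iff_odd] at hk
    have hto : Odd (t * (6 * t - 1)) := by rw [h1]; exact hk.pow
    have hto : Odd t := (Int.odd_mul.mp hto).1
    have hao : Odd a := by
      rcases ha with ha | ha
      · rw [ha] at hto; exact (Int.odd_pow' (by norm_num)).mp hto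
      · rw [ha] at hto; exact (Int.odd_pow' (two_ne_zero)).mp (odd_neg.mp hto)
    have ha8 : a ^ 2 % 8 = 1 := by
      have := Int.emod_emod_of_dvd a (show (2 : ℤ) ∣ 8 by norm_num)
      rw [Int.odd_iff.mp hao] at this
      have h8 : a % 8 = 1 ∨ a % 8 = 3 ∨ a % 8 = 5 ∨ a % 8 = 7 := by omega
      rcases h8 with h8 | h8 | h8 | h8 <;> simp [pow_two, Int.mul_emod, h8]
    have hb24 : b ^ 2 % 8 = 0 ∨ b ^ 2 % 8 = 1 ∨ b ^ 2 % 8 = 4 := by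
      have h8 : b % 8 = 0 ∨ b % 8 = 1 ∨ b % 8 = 2 ∨ b % 8 = 3 ∨ b % 8 = 4 ∨ b % 8 = 5 ∨
        b % 8 = 6 ∨ b % 8 = 7 := by omega
      rcases h8 with h8 | h8 | h8 | h8 | h8 | h8 | h8 | h8 <;> simp [pow_two, Int.mul_emod, h8]
    have hb3 : b ^ 2 % 3 = 0 ∨ b ^ 2 % 3 = 1 := by
      have h8 : b % 3 = 0 ∨ b % 3 = 1 ∨ b % 3 = 2 := by omega
      rcases h8 with h8 | h8 | h8 <;> simp [pow_two, Int.mul_emod, h8]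
    have ha0 := sq_nonneg a
    have hb0 := sq_nonneg b
    omega
  · rw [← Int.not_even_iff_odd] at hm
    simp only [hm, false_iff]
    rw [Int.not_even_iff_odd] at hm
    obtain ⟨t, ht⟩ : ∃ t, 3 * m - 1 = 2 * t := ⟨(3 * m - 1) / 2, by
      have := Int.odd_iff.mp hm; omega⟩
    have h1 : m * t = k ^ 2 := by rw [ht] at h; linarith
    have hc : IsCoprime m t := ⟨3, -2, by linarith⟩
    obtain ⟨a, ha⟩ := Int.sq_of_isCoprime hc h1
    obtain ⟨b, hb⟩ := Int.sq_of_isCoprime hc.symm (by rw [mul_comm]; exact h1)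
    intro hk
    have hke : Even (m * t) := by rw [h1]; exact (Int.even_pow' (by norm_num)).mpr hk
    have hte : Even t := by
      rcases Int.even_mul.mp hke with h' | h'
      · exact absurd h' (Int.not_even_iff_odd.mpr hm)
      · exact h'
    have hao : Odd a := by
      rcases ha with ha | ha
      · rw [ha] at hm; exact (Int.odd_pow' (by norm_num)).mp hm
      · rw [ha] at hm; exact (Int.odd_pow' (two_ne_zero)).mp (odd_neg.mp hm)
    have ha8 : a ^ 2 % 8 = 1 := by
      have := Int.emod_emod_of_dvd a (show (2 : ℤ) ∣ 8 by norm_num)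
      rw [Int.odd_iff.mp hao] at this
      have h8 : a % 8 = 1 ∨ a % 8 = 3 ∨ a % 8 = 5 ∨ a % 8 = 7 := by omega
      rcases h8 with h8 | h8 | h8 | h8 <;> simp [pow_two, Int.mul_emod, h8]
    have hb8 : b ^ 2 % 8 = 0 ∨ b ^ 2 % 8 = 1 ∨ b ^ 2 % 8 = 4 := by
      have h8 : b % 8 = 0 ∨ b % 8 = 1 ∨ b % 8 = 2 ∨ b % 8 = 3 ∨ b % 8 = 4 ∨ b % 8 = 5 ∨
        b % 8 = 6 ∨ b % 8 = 7 := by omega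
      rcases h8 with h8 | h8 | h8 | h8 | h8 | h8 | h8 | h8 <;> simp [pow_two, Int.mul_emod, h8]
    rw [Int.even_iff] at hte
    have ha0 := sq_nonneg a
    have hb0 := sq_nonneg b
    omega

end EvenSmallest


/-- `D⁺_even(n) - D⁻_even(n)` equals `-1` if `n` is an even square that is not pentagonal,
`1` if `n` is an odd square that is not pentagonal, `1` if `n` is an even-index pentagonal
number that is not a square, `-1` if `n` is an odd-index pentagonal number that is not a
square, and `0` otherwise.  Here `D⁺_even(n)` (resp. `D⁻_even(n)`) counts partitions of `n`
into an even (resp. odd) number of distinct parts whose smallest part is even, and `n` is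
pentagonal iff `2n = m(3m-1)` for some integer `m`. -/
theorem stmt4 (n : ℕ) (hn : 0 < n) (D : ℤ)
    (hD : D = ((Finset.univ.filter fun l : n.Partition =>
        l.parts.Nodup ∧ Even (Multiset.card l.parts) ∧
          ∃ s ∈ l.parts, Even s ∧ ∀ x ∈ l.parts, s ≤ x).card : ℤ) -
      ((Finset.univ.filter fun l : n.Partition =>
        l.parts.Nodup ∧ Odd (Multiset.card l.parts) ∧
          ∃ s ∈ l.parts, Even s ∧ ∀ x ∈ l.parts, s ≤ x).card : ℤ)) :
    (IsSquare n ∧ Even n ∧ ¬(∃ m : ℤ, 2 * (n : ℤ) = m * (3 * m - 1)) → D = -1) ∧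
    (IsSquare n ∧ Odd n ∧ ¬(∃ m : ℤ, 2 * (n : ℤ) = m * (3 * m - 1)) → D = 1) ∧
    ((∃ m : ℤ, Even m ∧ 2 * (n : ℤ) = m * (3 * m - 1)) ∧ ¬IsSquare n → D = 1) ∧
    ((∃ m : ℤ, Odd m ∧ 2 * (n : ℤ) = m * (3 * m - 1)) ∧ ¬IsSquare n → D = -1) ∧
    (¬(IsSquare n ∧ ¬(∃ m : ℤ, 2 * (n : ℤ) = m * (3 * m - 1))) ∧
      ¬((∃ m : ℤ, 2 * (n : ℤ) = m * (3 * m - 1)) ∧ ¬IsSquare n) → D = 0) := by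
  obtain ⟨N, hN, hE⟩ := EvenSmallest.coeff_E_main hn
  rw [EvenSmallest.D_eq hN, hE] at hD
  clear hE
  refine ⟨?_, ?_, ?_, ?_, ?_⟩
  · rintro ⟨⟨j, hj⟩, he, hp⟩
    have hj0 : 0 < j := Nat.pos_of_ne_zero (by rintro rfl; omega)
    have hje : Even j := by
      rw [hj, Nat.even_mul] at he; tauto
    rw [hD, EvenSmallest.pent_coeff' hp, EvenSmallest.sq_sum hN j hj0 (by rw [hj]; ring),
      hje.neg_one_pow]
    norm_num
  · rintro ⟨⟨j, hj⟩, he, hp⟩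
    have hj0 : 0 < j := Nat.pos_of_ne_zero (by rintro rfl; omega)
    have hje : Odd j := by
      rw [hj, Nat.odd_mul] at he; tauto
    rw [hD, EvenSmallest.pent_coeff' hp, EvenSmallest.sq_sum hN j hj0 (by rw [hj]; ring),
      hje.neg_one_pow]
    norm_num
  · rintro ⟨⟨m, hm, hmn⟩, hs⟩
    rw [hD, EvenSmallest.pent_coeff hmn, EvenSmallest.sq_sum' hs, Int.negOnePow_even m hm]
    norm_num
  · rintro ⟨⟨m, hm, hmn⟩, hs⟩
    rw [hD, EvenSmallest.pent_coeff hmn, EvenSmallest.sq_sum' hs, Int.negOnePow_odd m hm]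
    norm_num
  · rintro ⟨h1, h2⟩
    by_cases hs : IsSquare n
    · have hp : ∃ m : ℤ, 2 * (n : ℤ) = m * (3 * m - 1) := by
        by_contra hp; exact h1 ⟨hs, hp⟩
      obtain ⟨m, hm⟩ := hp
      obtain ⟨j, hj⟩ := hs
      have hj0 : 0 < j := Nat.pos_of_ne_zero (by rintro rfl; omega)
      have hpar := EvenSmallest.parity (m := m) (k := j) (by rw [← hm, hj]; push_cast; ring)
      rw [hD, EvenSmallest.pent_coeff hm, EvenSmallest.sq_sum hN j hj0 (by rw [hj]; ring)]
      rw [Int.even_coe_nat] at hpar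
      rcases Int.even_or_odd m with hme | hmo
      · rw [Int.negOnePow_even m hme, (hpar.mp hme).neg_one_pow]; norm_num
      · have hjo : Odd j := by
          rw [← Nat.not_even_iff_odd, ← hpar, Int.not_even_iff_odd]; exact hmo
        rw [Int.negOnePow_odd m hmo, hjo.neg_one_pow]; norm_num
    · have hp : ¬ ∃ m : ℤ, 2 * (n : ℤ) = m * (3 * m - 1) := fun hp => h2 ⟨hp, hs⟩
      rw [hD, EvenSmallest.pent_coeff' hp, EvenSmallest.sq_sum' hs]
      norm_num
end
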